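/- The Cayley table of the cyclic group Z_7 (the Latin square of order 7 with entry (i+j) mod 7 in row i and column j, for i,j ∈ {0,…,6}) contains no Latin trade of size less than 9; in particular it contains no intercalates. -/

import Mathlib

/-- A Latin square of order `n`, represented as a function giving the entry in
row `i`, column `j`: every element occurs exactly once in each row and column. -/
def IsLatinSquare {n : ℕ} (L : Fin n → Fin n → Fin n) : Prop :=
  (∀ i, Function.Injective (L i)) ∧ (∀ j, Function.Injective fun i => L i j)

/-- The set of triples `(i, j; L i j)` of a square `L`. -/
def entries {n : ℕ} (L : Fin n → Fin n → Fin n) : Finset (Fin n × Fin n × Fin n) :=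
  Finset.univ.image fun p : Fin n × Fin n => (p.1, p.2, L p.1 p.2)

/-- `T` is a Latin trade in `L`: the (nonempty) set of entries of `L` in the positions
where `L` differs from some other Latin square `L'` of the same order. -/
def IsTrade {n : ℕ} (L : Fin n → Fin n → Fin n)
    (T : Finset (Fin n × Fin n × Fin n)) : Prop :=
  ∃ L' : Fin n → Fin n → Fin n, IsLatinSquare L' ∧ L' ≠ L ∧
    T = (Finset.univ.filter fun p : Fin n × Fin n => L p.1 p.2 ≠ L' p.1 p.2).image
          fun p => (p.1, p.2, L p.1 p.2)

/-- `U` is a uniquely completable set for `L`: `U ⊆ L` and `L` is the only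
Latin square of order `n` containing `U`. -/
def IsUC {n : ℕ} (L : Fin n → Fin n → Fin n)
    (U : Finset (Fin n × Fin n × Fin n)) : Prop :=
  U ⊆ entries L ∧
    ∀ L' : Fin n → Fin n → Fin n, IsLatinSquare L' → U ⊆ entries L' → L' = L

/-- `C` is a critical set of `L`: a uniquely completable set for `L`,
no proper subset of which is uniquely completable. -/
def IsCritical {n : ℕ} (L : Fin n → Fin n → Fin n)
    (C : Finset (Fin n × Fin n × Fin n)) : Prop :=
  IsUC L C ∧ ∀ C' ⊂ C, ¬ IsUC L C'

/-- `scs n`: the smallest size of a critical set in any Latin square of order `n`. -/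
noncomputable def scs (n : ℕ) : ℕ :=
  sInf {s | ∃ (L : Fin n → Fin n → Fin n) (C : Finset (Fin n × Fin n × Fin n)),
    IsLatinSquare L ∧ IsCritical L C ∧ C.card = s}

/-- `R(T)`: the number of distinct rows occurring in `T`. -/
def rowCount {n : ℕ} (T : Finset (Fin n × Fin n × Fin n)) : ℕ :=
  (T.image fun t => t.1).card

/-- `C(T)`: the number of distinct columns occurring in `T`. -/
def colCount {n : ℕ} (T : Finset (Fin n × Fin n × Fin n)) : ℕ :=
  (T.image fun t => t.2.1).card

/-- `E(T)`: the number of distinct elements occurring in `T`. -/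
def elemCount {n : ℕ} (T : Finset (Fin n × Fin n × Fin n)) : ℕ :=
  (T.image fun t => t.2.2).card

/-- The positions at which `L` differs from the addition table of `Fin 7`. -/
def changedCells (L : Fin 7 → Fin 7 → Fin 7) : Finset (Fin 7 × Fin 7) :=
  Finset.univ.filter fun p => p.1 + p.2 ≠ L p.1 p.2

/-- The positions of a list of triples. -/
def cellsOf (filled : List (Fin 7 × Fin 7 × Fin 7)) : List (Fin 7 × Fin 7) :=
  filled.map fun t => (t.1, t.2.1)

/-- Add the cell `c` to `todo` unless it is already among `filled` or `todo`. -/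
def enqueue (filled : List (Fin 7 × Fin 7 × Fin 7)) (c : Fin 7 × Fin 7)
    (todo : List (Fin 7 × Fin 7)) : List (Fin 7 × Fin 7) :=
  if c ∈ cellsOf filled ++ todo then todo else c :: todo

/-- Depth-first refutation of trades with at most 8 cells in the addition table of `Fin 7`.
Here `filled` holds cells together with their new symbol and `todo` holds cells known to change
whose new symbol is still open. The value `true` means that every branch ends with more than
8 changed cells or with a symbol repeated in a row or column. -/
def refute : ℕ → List (Fin 7 × Fin 7 × Fin 7) → List (Fin 7 × Fin 7) → Bool
  | 0, _, _ => false
  | fuel + 1, filled, todo =>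
    if 8 < filled.length + todo.length then true
    else match todo with
      | [] => false
      | (i, j) :: rest =>
        [0, 1, 2, 3, 4, 5, 6].all fun v =>
          v == i + j ||
          (filled.any fun t => t.2.2 == v && (t.1 == i || t.2.1 == j)) ||
          refute fuel ((i, j, v) :: filled)
            (enqueue ((i, j, v) :: filled) (i, v - i)
              (enqueue ((i, j, v) :: filled) (v - j, j) rest))

/-- `filled` and `todo` correctly describe part of the difference between `L` and the
addition table. -/
structure Describes (L : Fin 7 → Fin 7 → Fin 7) (filled : List (Fin 7 × Fin 7 × Fin 7))
    (todo : List (Fin 7 × Fin 7)) : Prop where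
  nodup : (cellsOf filled ++ todo).Nodup
  changed : ∀ c ∈ cellsOf filled ++ todo, c ∈ changedCells L
  value : ∀ t ∈ filled, L t.1 t.2.1 = t.2.2

theorem Describes.length_le {L : Fin 7 → Fin 7 → Fin 7}
    {filled : List (Fin 7 × Fin 7 × Fin 7)} {todo : List (Fin 7 × Fin 7)}
    (h : Describes L filled todo) : filled.length + todo.length ≤ (changedCells L).card := by
  have hsub : (cellsOf filled ++ todo).toFinset ⊆ changedCells L := fun c hc =>
    h.changed c (List.mem_toFinset.1 hc)
  have hcard := Finset.card_le_card hsub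
  rw [List.toFinset_card_of_nodup h.nodup] at hcard
  simpa [cellsOf] using hcard

theorem Describes.enqueue {L : Fin 7 → Fin 7 → Fin 7}
    {filled : List (Fin 7 × Fin 7 × Fin 7)} {todo : List (Fin 7 × Fin 7)}
    (h : Describes L filled todo) {c : Fin 7 × Fin 7} (hc : c ∈ changedCells L) :
    Describes L filled (enqueue filled c todo) := by
  unfold _root_.enqueue
  split_ifs with hmem
  · exact h
  · refine ⟨List.nodup_middle.2 (List.nodup_cons.2 ⟨hmem, h.nodup⟩), fun d hd => ?_, h.value⟩
    rcases List.mem_cons.1 (List.perm_middle.mem_iff.1 hd) with rfl | hd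
    · exact hc
    · exact h.changed d hd

theorem Describes.fill {L : Fin 7 → Fin 7 → Fin 7}
    {filled : List (Fin 7 × Fin 7 × Fin 7)} {todo : List (Fin 7 × Fin 7)} {i j : Fin 7}
    (h : Describes L filled ((i, j) :: todo)) : Describes L ((i, j, L i j) :: filled) todo := by
  have hperm : (cellsOf ((i, j, L i j) :: filled) ++ todo).Perm
      (cellsOf filled ++ (i, j) :: todo) := List.perm_middle.symm
  refine ⟨hperm.nodup_iff.2 h.nodup, fun c hc => h.changed c (hperm.mem_iff.1 hc), fun t ht => ?_⟩
  rcases List.mem_cons.1 ht with rfl | ht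
  · rfl
  · exact h.value t ht

/-- In a Latin square, the cells that held the new symbol of a changed cell, in its row and in
its column, change too. -/
theorem IsLatinSquare.changed_of_changed {L : Fin 7 → Fin 7 → Fin 7} (hL : IsLatinSquare L)
    {i j : Fin 7} (h : (i, j) ∈ changedCells L) :
    (i, L i j - i) ∈ changedCells L ∧ (L i j - j, j) ∈ changedCells L := by
  simp only [changedCells, Finset.mem_filter, Finset.mem_univ, true_and] at h ⊢
  constructor
  · intro heq
    rw [add_sub_cancel] at heq
    exact h (add_comm i j ▸ (eq_sub_iff_add_eq.1 (hL.1 i heq)))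
  · intro heq
    rw [sub_add_cancel] at heq
    exact h (eq_sub_iff_add_eq.1 (hL.2 j heq))

theorem not_describes_of_refute {L : Fin 7 → Fin 7 → Fin 7} (hL : IsLatinSquare L)
    (hcard : (changedCells L).card ≤ 8) (fuel : ℕ) (filled : List (Fin 7 × Fin 7 × Fin 7))
    (todo : List (Fin 7 × Fin 7)) (hr : refute fuel filled todo = true) :
    ¬ Describes L filled todo := by
  induction fuel generalizing filled todo with
  | zero => simp [refute] at hr
  | succ fuel ih =>
    intro h
    have hlen := h.length_le
    rw [refute.eq_def] at hr
    dsimp only at hr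
    rw [if_neg (by omega)] at hr
    match todo, h, hr with
    | (i, j) :: rest, h, hr =>
      have hij : (i, j) ∈ changedCells L := h.changed _ (by simp)
      have hne : i + j ≠ L i j := by simpa [changedCells] using hij
      have hmem : L i j ∈ ([0, 1, 2, 3, 4, 5, 6] : List (Fin 7)) := by
        generalize L i j = v
        revert v
        decide
      have hv := List.all_eq_true.1 hr (L i j) hmem
      simp only [Bool.or_eq_true, beq_iff_eq, List.any_eq_true, Bool.and_eq_true] at hv
      rcases hv with (hv | ⟨⟨a, b, w⟩, ht, hw, hab⟩) | hv
      · exact hne hv.symm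
      · have hval : L a b = L i j := (h.value _ ht).trans hw
        have hcell : (a, b) = (i, j) := by
          rcases hab with hab | hab
          · obtain rfl : a = i := hab
            rw [hL.1 a hval]
          · obtain rfl : b = j := hab
            rw [hL.2 b hval]
        have hab_mem : (a, b) ∈ cellsOf filled := List.mem_map.2 ⟨_, ht, rfl⟩
        exact (List.nodup_append.1 h.nodup).2.2 _ hab_mem (i, j) (by simp) hcell
      · obtain ⟨hrow, hcol⟩ := hL.changed_of_changed hij
        exact ih _ _ hv ((h.fill.enqueue hcol).enqueue hrow)

theorem refute_origin : refute 8 [(0, 0, 1)] [(0, 1), (1, 0)] = true := by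
  decide +kernel

theorem nine_le_card_changedCells_of_origin {L : Fin 7 → Fin 7 → Fin 7} (hL : IsLatinSquare L)
    (h : L 0 0 = 1) : 9 ≤ (changedCells L).card := by
  have h00 : (0, 0) ∈ changedCells L := by simp [changedCells, h]
  obtain ⟨hrow, hcol⟩ := hL.changed_of_changed h00
  rw [h, sub_zero] at hrow hcol
  by_contra! hlt
  refine not_describes_of_refute hL (Nat.le_of_lt_succ hlt) 8 [(0, 0, 1)] [(0, 1), (1, 0)]
    refute_origin ⟨by decide, ?_, by simpa using h⟩
  simpa [cellsOf] using ⟨h00, hrow, hcol⟩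

open Fin.CommRing in
/-- An affine change of coordinates moves any changed cell to the origin, with new symbol `1`. -/
theorem nine_le_card_changedCells {L : Fin 7 → Fin 7 → Fin 7} (hL : IsLatinSquare L)
    {a b : Fin 7} (h : (a, b) ∈ changedCells L) : 9 ≤ (changedCells L).card := by
  have hne : L a b - (a + b) ≠ 0 := by
    simpa [changedCells, sub_eq_zero, eq_comm] using h
  obtain ⟨d, hd⟩ : ∃ d, d * (L a b - (a + b)) = 1 := by
    revert hne
    generalize L a b - (a + b) = c
    revert c
    decide
  set c := L a b - (a + b) with hc
  have hcinj : Function.Injective fun x : Fin 7 => c * x := fun x y hxy => by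
    linear_combination d * hxy - (x - y) * hd
  have hdinj : Function.Injective fun x : Fin 7 => d * x := fun x y hxy => by
    linear_combination c * hxy - (x - y) * hd
  have hmove : IsLatinSquare fun i j => d * (L (c * i + a) (c * j + b) - (a + b)) :=
    ⟨fun i _ _ hjk => hcinj (add_right_cancel (hL.1 _ (sub_left_injective (hdinj hjk)))),
      fun j _ _ hik => hcinj (add_right_cancel (hL.2 _ (sub_left_injective (hdinj hik))))⟩
  refine (nine_le_card_changedCells_of_origin hmove ?_).trans
    (Finset.card_le_card_of_injOn (fun p => (c * p.1 + a, c * p.2 + b)) (fun p hp => ?_) ?_)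
  · simpa [← hc] using hd
  · simp only [changedCells, Finset.coe_filter, Finset.mem_univ, true_and, Set.mem_ofPred_eq]
      at hp ⊢
    intro heq
    apply hp
    rw [← heq]
    linear_combination -(p.1 + p.2) * hd
  · rintro ⟨i, j⟩ - ⟨k, l⟩ - hp
    simp only [Prod.mk.injEq] at hp
    exact Prod.ext (hcinj (add_right_cancel hp.1)) (hcinj (add_right_cancel hp.2))

/-- The Cayley table of `ℤ₇` (entry `i + j` in row `i`, column `j`) contains no
Latin trade of size less than 9; in particular it contains no intercalates. -/
theorem Z7_no_small_trades :
    (∀ T : Finset (Fin 7 × Fin 7 × Fin 7),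
        IsTrade (fun i j => i + j) T → 9 ≤ T.card) ∧
    ∀ T : Finset (Fin 7 × Fin 7 × Fin 7),
        IsTrade (fun i j => i + j) T → T.card ≠ 4 := by
  have key : ∀ T : Finset (Fin 7 × Fin 7 × Fin 7),
      IsTrade (fun i j => i + j) T → 9 ≤ T.card := by
    rintro _ ⟨L, hL, hne, rfl⟩
    obtain ⟨a, ha⟩ := Function.ne_iff.1 hne
    obtain ⟨b, hab⟩ := Function.ne_iff.1 ha
    rw [Finset.card_image_of_injective _ fun p q hpq => by
      simp only [Prod.mk.injEq] at hpq
      exact Prod.ext hpq.1 hpq.2.1]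
    exact nine_le_card_changedCells hL (a := a) (b := b)
      (Finset.mem_filter.2 ⟨Finset.mem_univ _, hab.symm⟩)
  refine ⟨key, fun T hT h4 => ?_⟩
  have := key T hT
  omega
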